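/- An element ω = Σ_{1≤i<j≤4} Π_{ij} e_i∧e_j of ⋀^2 k^4 is decomposable if and only if Π_{12}Π_{34} − Π_{13}Π_{24} + Π_{14}Π_{23} = 0. -/

import Mathlib

open ExteriorAlgebra

noncomputable section

variable (k : Type*) [Field k]

/-- The alternating map giving the coordinate `Π_idx` (antisymmetric in `idx`). -/
def coordA {n : ℕ} (q : ℕ) (idx : Fin q → Fin n) :
    (Fin n → k) [⋀^Fin q]→ₗ[k] k :=
  (Matrix.detRowAlternating : (Fin q → k) [⋀^Fin q]→ₗ[k] k).compLinearMap
    (LinearMap.funLeft k k idx)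

/-- The coordinate functional `Π_idx` on the exterior algebra. -/
def coordF {n : ℕ} (q : ℕ) (idx : Fin q → Fin n) :
    ExteriorAlgebra k (Fin n → k) →ₗ[k] k :=
  ExteriorAlgebra.liftAlternating
    (Function.update (fun i => (0 : (Fin n → k) [⋀^Fin i]→ₗ[k] k)) q (coordA k q idx))

/-- Decomposability of an element of the exterior algebra, in degree `q`. -/
def IsDecomp {n : ℕ} (q : ℕ) (x : ExteriorAlgebra k (Fin n → k)) : Prop :=
  ∃ v : Fin q → (Fin n → k), x = ExteriorAlgebra.ιMulti k q v

/-- The dual isomorphism `δ` on the degree-`p` part, with values in degree `n-p`. -/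
def dualAt (n p : ℕ) (ω : ExteriorAlgebra k (Fin n → k)) :
    ExteriorAlgebra k (Fin n → k) :=
  ∑ s : {s : Finset (Fin n) // s.card = p},
    coordF k p (fun a => (s.1.orderIsoOfFin s.2 a : Fin n)) ω •
      ExteriorAlgebra.ιMulti k (n - p)
        (fun a => Pi.single (((s.1ᶜ).orderIsoOfFin
          (by rw [Finset.card_compl, s.2, Fintype.card_fin]) a : Fin n)) (1 : k))

/-- The index tuple `(α_i, α_j, β_1^{ε_1}, …, β_m^{ε_m}, γ_1, …, γ_c)`. -/
def tupleP {n : ℕ} (m c : ℕ) (α : Fin 4 → Fin n) (β : Fin m → Fin 2 → Fin n)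
    (γ : Fin c → Fin n) (i j : Fin 4) (ε : Fin m → Fin 2) : Fin (2 + (m + c)) → Fin n :=
  Fin.append ![α i, α j] (Fin.append (fun l => β l (ε l)) γ)

/-- The functional `π_{ij} = Π_{α_i α_j β⃗_1 … β⃗_m γ_1 … γ_c}`. -/
def piF {n : ℕ} (m c : ℕ) (α : Fin 4 → Fin n) (β : Fin m → Fin 2 → Fin n)
    (γ : Fin c → Fin n) (i j : Fin 4) :
    ExteriorAlgebra k (Fin n → k) →ₗ[k] k :=
  ∑ ε : Fin m → Fin 2, coordF k (2 + (m + c)) (tupleP m c α β γ i j ε)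

/-- The rank 6 quadratic form `P'_{A,B,C}`. -/
def Pprime {n : ℕ} (m c : ℕ) (α : Fin 4 → Fin n) (β : Fin m → Fin 2 → Fin n)
    (γ : Fin c → Fin n) (ω : ExteriorAlgebra k (Fin n → k)) : k :=
  piF k m c α β γ 0 1 ω * piF k m c α β γ 2 3 ω
    - piF k m c α β γ 0 2 ω * piF k m c α β γ 1 3 ω
    + piF k m c α β γ 0 3 ω * piF k m c α β γ 1 2 ω

/-- The ordering/distinctness conditions on the triple `(A,B,C)`. -/
def OrderedABC {n : ℕ} (m c : ℕ) (α : Fin 4 → Fin n) (β : Fin m → Fin 2 → Fin n)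
    (γ : Fin c → Fin n) : Prop :=
  Function.Injective (Sum.elim α (Sum.elim (fun x : Fin m × Fin 2 => β x.1 x.2) γ)) ∧
    StrictMono α ∧ (∀ l, β l 0 < β l 1) ∧
    (∀ ν : Fin 2, StrictMono fun l => β l ν) ∧
    (∀ l, β l 0 < α 0) ∧ (∀ l, β l 1 < α 2) ∧ StrictMono γ

/-- The set `S' = A ∪ B_1 ∪ C`. -/
def SP {n : ℕ} (m c : ℕ) (α : Fin 4 → Fin n) (β : Fin m → Fin 2 → Fin n)
    (γ : Fin c → Fin n) : Finset (Fin n) :=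
  Finset.univ.image α ∪ Finset.univ.image (fun l => β l 1) ∪ Finset.univ.image γ

open Classical in
/-- The matrix of the map `X_{A,B,C} : k^n → k^{p+2}`. -/
def Xmat (p : ℕ) {n : ℕ} (m c : ℕ) (α : Fin 4 → Fin n) (β : Fin m → Fin 2 → Fin n)
    (γ : Fin c → Fin n) : Matrix (Fin (p + 2)) (Fin n) k :=
  if h : (SP m c α β γ).card = p + 2 then
    fun j i =>
      (if i = ((SP m c α β γ).orderIsoOfFin h j : Fin n) then 1 else 0) +
        ∑ l : Fin m,
          if i = β l 0 ∧ β l 1 = ((SP m c α β γ).orderIsoOfFin h j : Fin n) then 1 else 0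
  else 0

/-- The linear map `X_{A,B,C} : k^n → k^{p+2}`. -/
def XL (p : ℕ) {n : ℕ} (m c : ℕ) (α : Fin 4 → Fin n) (β : Fin m → Fin 2 → Fin n)
    (γ : Fin c → Fin n) : (Fin n → k) →ₗ[k] (Fin (p + 2) → k) :=
  (Xmat k p m c α β γ).mulVecLin

open Classical in
/-- The matrix of the map `Z : k^{p+2} → k^4`. -/
def Zmat (p : ℕ) {n : ℕ} (m c : ℕ) (α : Fin 4 → Fin n) (β : Fin m → Fin 2 → Fin n)
    (γ : Fin c → Fin n) : Matrix (Fin 4) (Fin (p + 2)) k :=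
  fun j i => if XL k p m c α β γ (Pi.single (α j) 1) = Pi.single i 1 then 1 else 0

/-- The linear map `Z : k^{p+2} → k^4`. -/
def ZL (p : ℕ) {n : ℕ} (m c : ℕ) (α : Fin 4 → Fin n) (β : Fin m → Fin 2 → Fin n)
    (γ : Fin c → Fin n) : (Fin (p + 2) → k) →ₗ[k] (Fin 4 → k) :=
  (Zmat k p m c α β γ).mulVecLin

/-- The Grassmann cone preserving map `G_{A,B,C} = ⋀²Z ∘ δ ∘ ⋀^p X_{A,B,C}`. -/
def GABC (p : ℕ) {n : ℕ} (m c : ℕ) (α : Fin 4 → Fin n) (β : Fin m → Fin 2 → Fin n)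
    (γ : Fin c → Fin n) (ω : ExteriorAlgebra k (Fin n → k)) :
    ExteriorAlgebra k (Fin 4 → k) :=
  ExteriorAlgebra.map (ZL k p m c α β γ)
    (dualAt k (p + 2) p (ExteriorAlgebra.map (XL k p m c α β γ) ω))

/-- The general Plücker quadratic form `P_{A,B}` for index sequences
`a : Fin d → Fin n` and `b : Fin (e+1) → Fin n`. -/
def Pluecker {n : ℕ} (d e : ℕ) (a : Fin d → Fin n) (b : Fin (e + 1) → Fin n)
    (ω : ExteriorAlgebra k (Fin n → k)) : k :=
  ∑ i : Fin (e + 1), (-1 : k) ^ (i : ℕ) *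
    (coordF k (d + 1) (Fin.snoc a (b i)) ω * coordF k e (fun j => b (i.succAbove j)) ω)


theorem coordF_ιMulti {k : Type*} [Field k] {n q : ℕ} (idx : Fin q → Fin n)
    (v : Fin q → Fin n → k) :
    coordF k q idx (ExteriorAlgebra.ιMulti k q v) = (Matrix.of fun i j => v i (idx j)).det := by
  simp only [coordF, ExteriorAlgebra.liftAlternating_apply_ιMulti, Function.update_self]
  rfl

theorem coordF_ιMulti_two {k : Type*} [Field k] {n : ℕ} (i j : Fin n) (v : Fin 2 → Fin n → k) :
    coordF k 2 ![i, j] (ExteriorAlgebra.ιMulti k 2 v) = v 0 i * v 1 j - v 0 j * v 1 i := by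
  rw [coordF_ιMulti, Matrix.det_fin_two]
  rfl

/-- An element of the exterior power is determined by its coordinates at increasing indices. -/
theorem exteriorPower_ext_coordF {k : Type*} [Field k] {n q : ℕ} {ω η : ⋀[k]^q (Fin n → k)}
    (h : ∀ idx : Fin q → Fin n, StrictMono idx → coordF k q idx ω.val = coordF k q idx η.val) :
    ω = η := by
  refine ((Pi.basisFun k (Fin n)).exteriorPower q).ext_elem fun s => ?_
  have key : exteriorPower.ιMultiDual k q (Pi.basisFun k (Fin n)) s =
      coordF k q (Set.powersetCard.ofFinEmbEquiv.symm s) ∘ₗ (⋀[k]^q (Fin n → k)).subtype := by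
    ext v
    simp [coordF_ιMulti]
  simpa [exteriorPower.basis_repr_apply, key] using
    h _ (Set.powersetCard.ofFinEmbEquiv.symm s).strictMono

theorem coordF_self {k : Type*} [Field k] {n : ℕ} (i : Fin n) (ω : ⋀[k]^2 (Fin n → k)) :
    coordF k 2 ![i, i] ω.val = 0 := by
  have key : coordF k 2 ![i, i] ∘ₗ (⋀[k]^2 (Fin n → k)).subtype = 0 := by
    ext v
    simp [-ExteriorAlgebra.ιMulti_succ_apply, coordF_ιMulti_two]
  exact LinearMap.congr_fun key ω

theorem coordF_swap {k : Type*} [Field k] {n : ℕ} (i j : Fin n) (ω : ⋀[k]^2 (Fin n → k)) :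
    coordF k 2 ![j, i] ω.val = -coordF k 2 ![i, j] ω.val := by
  have key : coordF k 2 ![j, i] ∘ₗ (⋀[k]^2 (Fin n → k)).subtype =
      -(coordF k 2 ![i, j] ∘ₗ (⋀[k]^2 (Fin n → k)).subtype) := by
    ext v
    simp [-ExteriorAlgebra.ιMulti_succ_apply, coordF_ιMulti_two]
  exact LinearMap.congr_fun key ω

/-- For an alternating `4 × 4` matrix, the single Plücker relation implies all of them. -/
theorem plucker_relation_all {R : Type*} [CommRing R] {p : Fin 4 → Fin 4 → R}
    (hself : ∀ i, p i i = 0) (hswap : ∀ i j, p j i = -p i j)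
    (h : p 0 1 * p 2 3 - p 0 2 * p 1 3 + p 0 3 * p 1 2 = 0) (a b i j : Fin 4) :
    p a i * p b j - p a j * p b i = p a b * p i j := by
  have h10 := hswap 0 1
  have h20 := hswap 0 2
  have h30 := hswap 0 3
  have h21 := hswap 1 2
  have h31 := hswap 1 3
  have h32 := hswap 2 3
  fin_cases a <;> fin_cases b <;> fin_cases i <;> fin_cases j <;>
    simp only [Fin.zero_eta, Fin.mk_one, Fin.reduceFinMk, hself, h10, h20, h30, h21, h31, h32] <;>
    first
      | ring1
      | linear_combination h
      | linear_combination -h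

/-- An element of `⋀²` whose coordinates satisfy all Plücker relations is decomposable. -/
theorem isDecomp_of_plucker {k : Type*} [Field k] {n : ℕ} (ω : ⋀[k]^2 (Fin n → k))
    (h : ∀ a b i j, coordF k 2 ![a, i] ω.val * coordF k 2 ![b, j] ω.val
      - coordF k 2 ![a, j] ω.val * coordF k 2 ![b, i] ω.val
      = coordF k 2 ![a, b] ω.val * coordF k 2 ![i, j] ω.val) :
    IsDecomp k 2 ω.val := by
  suffices ∃ v : Fin 2 → Fin n → k,
      ∀ i j, v 0 i * v 1 j - v 0 j * v 1 i = coordF k 2 ![i, j] ω.val by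
    obtain ⟨v, hv⟩ := this
    refine ⟨v, congrArg Subtype.val
      (exteriorPower_ext_coordF (η := exteriorPower.ιMulti k 2 v) fun idx _ => ?_)⟩
    have hidx : idx = ![idx 0, idx 1] := by
      ext i
      fin_cases i <;> rfl
    rw [hidx, exteriorPower.ιMulti_apply_coe, coordF_ιMulti_two, hv]
  by_cases! h0 : ∀ a b, coordF k 2 ![a, b] ω.val = 0
  · exact ⟨0, by simp [h0]⟩
  · obtain ⟨a, b, hab⟩ := h0
    refine ⟨![fun i => coordF k 2 ![a, i] ω.val,
      fun j => coordF k 2 ![b, j] ω.val / coordF k 2 ![a, b] ω.val], fun i j => ?_⟩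
    have := h a b i j
    simp only [Matrix.cons_val_zero, Matrix.cons_val_one]
    field_simp
    exact this

/-- An element `ω = Σ Π_{ij} e_i ∧ e_j` of `⋀² k⁴` is decomposable iff
`Π₁₂Π₃₄ − Π₁₃Π₂₄ + Π₁₄Π₂₃ = 0`. -/
theorem decomposable_iff_plucker_gr24
    {k : Type*} [Field k] (ω : ⋀[k]^2 (Fin 4 → k)) :
    IsDecomp k 2 ω.val ↔
      coordF k 2 ![0, 1] ω.val * coordF k 2 ![2, 3] ω.val
        - coordF k 2 ![0, 2] ω.val * coordF k 2 ![1, 3] ω.val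
        + coordF k 2 ![0, 3] ω.val * coordF k 2 ![1, 2] ω.val = 0 := by
  constructor
  · rintro ⟨v, hv⟩
    simp only [hv, coordF_ιMulti_two]
    ring
  · intro h
    exact isDecomp_of_plucker ω <|
      plucker_relation_all (p := fun i j => coordF k 2 ![i, j] ω.val)
        (fun i => coordF_self i ω) (fun i j => coordF_swap i j ω) h

end
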